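/- The element C_mir acts by a scalar on each finite-dimensional simple MU_v(2)-module, namely: C_mir acts on L^±(n,0) by ±(v^n + v^{−n−2})/(v − v^{−1}), on L^±(n,1) by ±(v^{n+2} + v^{−n})/(v − v^{−1}), and on L^±(n,01) by ±(v^n + v^{−n})/(v − v^{−1}); moreover these scalars are pairwise distinct as the module ranges over the list L^±(n,0), L^±(n,1) (n ∈ ℕ), L^±(n,01) (n ∈ ℕ₊). -/

import Mathlib

set_option synthInstance.maxHeartbeats 1000000
set_option maxHeartbeats 1000000

namespace MirabolicSL2

noncomputable section

/-- The base field `K = ℂ(v)`. -/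
abbrev K : Type := RatFunc ℂ

/-- The variable `v ∈ ℂ(v)`. -/
def vv : K := RatFunc.X

/-- The quantum integer `[m] = (v^m - v^{-m})/(v - v⁻¹)`. -/
def qn (m : ℤ) : K := (vv ^ m - vv ^ (-m)) / (vv - vv⁻¹)

/-- The five generators `e, f, k, k⁻¹, ℓ` of mirabolic quantum `sl₂`. -/
inductive G5 : Type | e | f | k | k' | l

open FreeAlgebra in
/-- The defining relations of mirabolic quantum `sl₂`. -/
inductive Rel : FreeAlgebra K G5 → FreeAlgebra K G5 → Prop
  | kk'  : Rel (ι K G5.k * ι K G5.k') 1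
  | k'k  : Rel (ι K G5.k' * ι K G5.k) 1
  | kek' : Rel (ι K G5.k * ι K G5.e * ι K G5.k') ((vv ^ 2) • ι K G5.e)
  | kfk' : Rel (ι K G5.k * ι K G5.f * ι K G5.k') ((vv ^ (-2 : ℤ)) • ι K G5.f)
  | effe : Rel (ι K G5.e * ι K G5.f - ι K G5.f * ι K G5.e)
      (((vv - vv⁻¹)⁻¹) • (ι K G5.k - ι K G5.k'))
  | ll   : Rel (ι K G5.l * ι K G5.l) (ι K G5.l)
  | kl   : Rel (ι K G5.k * ι K G5.l) (ι K G5.l * ι K G5.k)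
  | lel  : Rel (ι K G5.l * ι K G5.e * ι K G5.l) (ι K G5.l * ι K G5.e)
  | lfl  : Rel (ι K G5.l * ι K G5.f * ι K G5.l) (ι K G5.f * ι K G5.l)
  | serreE : Rel ((vv + vv⁻¹) • (ι K G5.e * ι K G5.l * ι K G5.e))
      (vv⁻¹ • (ι K G5.e * ι K G5.e * ι K G5.l) + vv • (ι K G5.l * (ι K G5.e * ι K G5.e)))
  | serreF : Rel ((vv + vv⁻¹) • (ι K G5.f * ι K G5.l * ι K G5.f))
      (vv⁻¹ • (ι K G5.l * (ι K G5.f * ι K G5.f)) + vv • (ι K G5.f * ι K G5.f * ι K G5.l))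

/-- Mirabolic quantum `sl₂`: the unital `K`-algebra presented by the generators
`e, f, k, k⁻¹, ℓ` and the relations `Rel`. -/
abbrev MU2 : Type := RingQuot Rel

/-- The generator `e` of `MU_v(2)`. -/
def Ee : MU2 := RingQuot.mkAlgHom K Rel (FreeAlgebra.ι K G5.e)
/-- The generator `f` of `MU_v(2)`. -/
def Ff : MU2 := RingQuot.mkAlgHom K Rel (FreeAlgebra.ι K G5.f)
/-- The generator `k` of `MU_v(2)`. -/
def Kk : MU2 := RingQuot.mkAlgHom K Rel (FreeAlgebra.ι K G5.k)
/-- The generator `k⁻¹` of `MU_v(2)`. -/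
def Kk' : MU2 := RingQuot.mkAlgHom K Rel (FreeAlgebra.ι K G5.k')
/-- The generator `ℓ` of `MU_v(2)`. -/
def Ll : MU2 := RingQuot.mkAlgHom K Rel (FreeAlgebra.ι K G5.l)

/-- The sign `±1`. -/
def sgn (pos : Bool) : K := if pos then 1 else -1

/-- The index type for the basis of `L^±(n,01)`: `Sum.inl i` is the basis vector
`m_{i,0}` (`0 ≤ i ≤ n-1`) and `Sum.inr j` is the basis vector `m_{j+1,1}`
(so that the second index ranges over `1 ≤ j+1 ≤ n`). -/
abbrev I01 (n : ℕ) : Type := Fin n ⊕ Fin n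

/-- The matrix of the action of `k` on `L^±(n,01)`: `k·m_{i,ε} = ±v^{n-2i} m_{i,ε}`. -/
def kMat01 (pos : Bool) (n : ℕ) : Matrix (I01 n) (I01 n) K := fun b b' =>
  if b = b' then
    (match b with
      | Sum.inl i => sgn pos * vv ^ ((n : ℤ) - 2 * ((i : ℕ) : ℤ))
      | Sum.inr j => sgn pos * vv ^ ((n : ℤ) - 2 * (((j : ℕ) : ℤ) + 1)))
  else 0

/-- The matrix of the action of `ℓ` on `L^±(n,01)`: `ℓ·m_{i,ε} = ε m_{i,ε}`. -/
def lMat01 (n : ℕ) : Matrix (I01 n) (I01 n) K := fun b b' =>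
  if b = b' then (match b with | Sum.inl _ => 0 | Sum.inr _ => 1) else 0

/-- The matrix of the action of `f` on `L^±(n,01)`:
`f·m_{i,0} = m_{i+1,0} + (v^i/[i+1]) m_{i+1,1}`, `f·m_{i,1} = v⁻¹([i]/[i+1]) m_{i+1,1}`. -/
def fMat01 (n : ℕ) : Matrix (I01 n) (I01 n) K := fun b b' =>
  match b, b' with
  | Sum.inl i, Sum.inl i' => if (i : ℕ) = (i' : ℕ) + 1 then 1 else 0
  | Sum.inr j, Sum.inl i' =>
      if (j : ℕ) = (i' : ℕ) then vv ^ ((i' : ℕ) : ℤ) / qn ((i' : ℕ) + 1) else 0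
  | Sum.inr j, Sum.inr j' =>
      if (j : ℕ) = (j' : ℕ) + 1 then vv⁻¹ * qn ((j' : ℕ) + 1) / qn ((j' : ℕ) + 2) else 0
  | Sum.inl _, Sum.inr _ => 0

/-- The matrix of the action of `e` on `L^±(n,01)`:
`e·m_{i,0} = ±v[i][n-i] m_{i-1,0}`,
`e·m_{i,1} = ±[i][n+1-i] m_{i-1,1} ± v^{i-n}[i] m_{i-1,0}`. -/
def eMat01 (pos : Bool) (n : ℕ) : Matrix (I01 n) (I01 n) K := fun b b' =>
  match b, b' with
  | Sum.inl i, Sum.inl i' =>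
      if (i : ℕ) + 1 = (i' : ℕ) then
        sgn pos * vv * qn ((i' : ℕ)) * qn ((n : ℤ) - ((i' : ℕ) : ℤ)) else 0
  | Sum.inl i, Sum.inr j' =>
      if (i : ℕ) = (j' : ℕ) then
        sgn pos * vv ^ ((((j' : ℕ) : ℤ) + 1) - (n : ℤ)) * qn (((j' : ℕ) : ℤ) + 1) else 0
  | Sum.inr j, Sum.inr j' =>
      if (j : ℕ) + 1 = (j' : ℕ) then
        sgn pos * qn (((j' : ℕ) : ℤ) + 1) * qn ((n : ℤ) - ((j' : ℕ) : ℤ)) else 0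
  | Sum.inr _, Sum.inl _ => 0

/-- The matrix of the action of `k` on `L^±(n,ε)`: `k·m_i = ±v^{n-2i} m_i`. -/
def kMatE (pos : Bool) (n : ℕ) : Matrix (Fin (n+1)) (Fin (n+1)) K :=
  Matrix.diagonal (fun i => sgn pos * vv ^ ((n : ℤ) - 2 * ((i : ℕ) : ℤ)))

/-- The matrix of the action of `ℓ` on `L^±(n,ε)`: `ℓ·m_i = ε m_i`. -/
def lMatE (eps : Bool) (n : ℕ) : Matrix (Fin (n+1)) (Fin (n+1)) K :=
  Matrix.diagonal (fun _ => if eps then 1 else 0)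

/-- The matrix of the action of `f` on `L^±(n,ε)`: `f·m_i = m_{i+1}` (`m_{n+1} = 0`). -/
def fMatE (n : ℕ) : Matrix (Fin (n+1)) (Fin (n+1)) K := fun i i' =>
  if (i : ℕ) = (i' : ℕ) + 1 then 1 else 0

/-- The matrix of the action of `e` on `L^±(n,ε)`:
`e·m_i = ±[i][n+1-i] m_{i-1}` (`m_{-1} = 0`). -/
def eMatE (pos : Bool) (n : ℕ) : Matrix (Fin (n+1)) (Fin (n+1)) K := fun i i' =>
  if (i : ℕ) + 1 = (i' : ℕ) then
    sgn pos * qn ((i' : ℕ)) * qn ((n : ℤ) + 1 - ((i' : ℕ) : ℤ)) else 0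

/-- Labels for the simple finite dimensional `MU_v(2)`-modules:
`L^±(n,0)`, `L^±(n,1)` for `n ∈ ℕ` and `L^±(n,01)` for `n ∈ ℕ₊`. -/
inductive Lab : Type
  | L0 (pos : Bool) (n : ℕ)
  | L1 (pos : Bool) (n : ℕ)
  | L01 (pos : Bool) (n : ℕ)

/-- A label is valid when (in the `L^±(n,01)` case) `n ≥ 1`. -/
def Lab.Valid : Lab → Prop
  | .L01 _ n => 1 ≤ n
  | _ => True

/-- The underlying vector space of the module with a given label. -/
def Carrier : Lab → Type
  | .L0 _ n => Fin (n+1) → K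
  | .L1 _ n => Fin (n+1) → K
  | .L01 _ n => I01 n → K

instance instAddCommGroupCarrier : (L : Lab) → AddCommGroup (Carrier L)
  | .L0 _ n => inferInstanceAs (AddCommGroup (Fin (n+1) → K))
  | .L1 _ n => inferInstanceAs (AddCommGroup (Fin (n+1) → K))
  | .L01 _ n => inferInstanceAs (AddCommGroup (I01 n → K))

instance instModuleCarrier : (L : Lab) → Module K (Carrier L)
  | .L0 _ n => inferInstanceAs (Module K (Fin (n+1) → K))
  | .L1 _ n => inferInstanceAs (Module K (Fin (n+1) → K))
  | .L01 _ n => inferInstanceAs (Module K (I01 n → K))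

/-- `ρ` is the standard representation of `MU_v(2)` attached to the label `L`. -/
def IsStd : (L : Lab) → (MU2 →ₐ[K] Module.End K (Carrier L)) → Prop
  | .L0 pos n => fun ρ =>
      ρ Ee = Matrix.toLin' (eMatE pos n) ∧ ρ Ff = Matrix.toLin' (fMatE n) ∧
      ρ Kk = Matrix.toLin' (kMatE pos n) ∧ ρ Ll = Matrix.toLin' (lMatE false n)
  | .L1 pos n => fun ρ =>
      ρ Ee = Matrix.toLin' (eMatE pos n) ∧ ρ Ff = Matrix.toLin' (fMatE n) ∧
      ρ Kk = Matrix.toLin' (kMatE pos n) ∧ ρ Ll = Matrix.toLin' (lMatE true n)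
  | .L01 pos n => fun ρ =>
      ρ Ee = Matrix.toLin' (eMat01 pos n) ∧ ρ Ff = Matrix.toLin' (fMat01 n) ∧
      ρ Kk = Matrix.toLin' (kMat01 pos n) ∧ ρ Ll = Matrix.toLin' (lMat01 n)

/-- The mirabolic quantum Casimir element `C_mir` (Definition 5.9). -/
def Cmir : MU2 :=
  (1 - vv ^ (-2 : ℤ)) •
      (Ff * Ee + (((vv - vv⁻¹) ^ 2)⁻¹) • (vv • Kk + vv⁻¹ • Kk'))
    - Ff * Ee * Ll - Ll * (Ff * Ee) + (vv ^ 2) • (Ff * Ll * Ee)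
    + (vv ^ (-2 : ℤ)) • (Ee * Ll * Ff)
    + ((vv ^ 2 - 2) * ((vv - vv⁻¹) ^ 2)⁻¹) • (Ll * (vv • Kk + vv⁻¹ • Kk'))
    + (vv ^ (-2 : ℤ) * ((vv - vv⁻¹) ^ 2)⁻¹) • (Ll * (vv⁻¹ • Kk + vv • Kk'))

/-- The scalar by which `C_mir` acts on the simple module with label `L`. -/
def casimirScalar : Lab → K
  | .L0 pos n => sgn pos * (vv ^ (n : ℤ) + vv ^ (-(n : ℤ) - 2)) / (vv - vv⁻¹)
  | .L1 pos n => sgn pos * (vv ^ ((n : ℤ) + 2) + vv ^ (-(n : ℤ))) / (vv - vv⁻¹)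
  | .L01 pos n => sgn pos * (vv ^ (n : ℤ) + vv ^ (-(n : ℤ))) / (vv - vv⁻¹)

section GenericField

variable {F V : Type*} [Field F] [AddCommGroup V] [Module F V]

/-- The quantum integer `[m]` at an arbitrary parameter `v`. -/
def qInt (v : F) (m : ℤ) : F := (v ^ m - v ^ (-m)) / (v - v⁻¹)

/-- The expression of `Cmir` evaluated at arbitrary endomorphisms of a vector space. -/
def casimirEnd (v : F) (e f k k' l : Module.End F V) : Module.End F V :=
  (1 - v ^ (-2 : ℤ)) • (f * e + (((v - v⁻¹) ^ 2)⁻¹) • (v • k + v⁻¹ • k'))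
    - f * e * l - l * (f * e) + (v ^ 2) • (f * l * e) + (v ^ (-2 : ℤ)) • (e * l * f)
    + ((v ^ 2 - 2) * ((v - v⁻¹) ^ 2)⁻¹) • (l * (v • k + v⁻¹ • k'))
    + (v ^ (-2 : ℤ) * ((v - v⁻¹) ^ 2)⁻¹) • (l * (v⁻¹ • k + v • k'))

lemma casimirEnd_apply (v : F) (e f k k' l : Module.End F V) (x : V) :
    casimirEnd v e f k k' l x =
      (1 - (v ^ 2)⁻¹) • (f (e x) + (((v - v⁻¹) ^ 2)⁻¹) • (v • k x + v⁻¹ • k' x))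
      - f (e (l x)) - l (f (e x)) + (v ^ 2) • f (l (e x)) + (v ^ 2)⁻¹ • e (l (f x))
      + ((v ^ 2 - 2) * ((v - v⁻¹) ^ 2)⁻¹) • l (v • k x + v⁻¹ • k' x)
      + ((v ^ 2)⁻¹ * ((v - v⁻¹) ^ 2)⁻¹) • l (v⁻¹ • k x + v • k' x) := by
  simp [casimirEnd]

lemma sub_inv_eq {v : F} (hv : v ≠ 0) : v - v⁻¹ = (v ^ 2 - 1) / v := by
  field_simp

lemma qInt_eq {v : F} (hv : v ≠ 0) (m : ℤ) :
    qInt v m = (v ^ m - (v ^ m)⁻¹) * v / (v ^ 2 - 1) := by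
  rw [qInt, sub_inv_eq hv, zpow_neg, div_div_eq_mul_div]

/-- The Casimir acts by a scalar on a string `m 0, m 1, …` on which `l` acts by the constant
`ε ∈ {0, 1}`. -/
lemma casimirEnd_apply_of_const {v s ε : F} (hv : v ≠ 0) (hv2 : v ^ 2 - 1 ≠ 0)
    (hε : ε = 0 ∨ ε = 1) {e f k k' l : Module.End F V} {m : ℕ → V} {n : ℕ}
    (hk : ∀ i : ℕ, k (m i) = (s * v ^ ((n : ℤ) - 2 * (i : ℤ))) • m i)
    (hk' : ∀ i : ℕ, k' (m i) = (s * (v ^ ((n : ℤ) - 2 * (i : ℤ)))⁻¹) • m i)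
    (hl : ∀ i, l (m i) = ε • m i)
    (hf : ∀ i, f (m i) = m (i + 1))
    (he_zero : e (m 0) = 0)
    (he : ∀ i : ℕ, i ≤ n →
      e (m (i + 1)) = (s * qInt v ((i : ℤ) + 1) * qInt v ((n : ℤ) - i)) • m i)
    (i : ℕ) (hi : i ≤ n) :
    casimirEnd v e f k k' l (m i) =
      (s * ((1 + ε * (v ^ 2 - 1)) * (v ^ (n : ℤ) + v ^ (-(n : ℤ) - 2))) / (v - v⁻¹)) • m i := by
  have hb : v ^ (n : ℤ) ≠ 0 := zpow_ne_zero _ hv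
  have z2 : v ^ (2 : ℤ) = v ^ 2 := zpow_ofNat v _
  rw [casimirEnd_apply]
  rcases i with _ | i
  · simp only [map_add, map_smul, hl, hk, hk', hf, he_zero, he 0 (Nat.zero_le n), qInt_eq hv,
      sub_inv_eq hv, Nat.cast_zero, mul_zero, sub_zero, zero_add, zpow_one, map_zero,
      zpow_sub₀ hv, zpow_neg, z2]
    generalize v ^ (n : ℤ) = b at *
    rcases hε with rfl | rfl <;> match_scalars <;> field_simp <;> ring
  · simp only [map_add, map_smul, hl, hk, hk', hf, he (i + 1) hi, he i (by omega), qInt_eq hv,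
      sub_inv_eq hv, Nat.cast_add, Nat.cast_one, zpow_add₀ hv, zpow_sub₀ hv, zpow_neg,
      zpow_one, zpow_mul', mul_add, z2]
    have ha : v ^ (i : ℤ) ≠ 0 := zpow_ne_zero _ hv
    generalize v ^ (n : ℤ) = b at *
    generalize v ^ (i : ℤ) = a at *
    rcases hε with rfl | rfl <;> match_scalars <;> field_simp <;> ring

/-- The Casimir acts by a scalar on a module of shape `L^±(n,01)`; here `m₁ j` stands for the
basis vector `m_{j+1,1}`. -/
lemma casimirEnd_apply_mixed {v s : F} (hv : v ≠ 0) (hv2 : ∀ i : ℕ, v ^ (2 * (i + 1)) - 1 ≠ 0)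
    {e f k k' l : Module.End F V} {m₀ m₁ : ℕ → V} {n : ℕ}
    (hk₀ : ∀ i : ℕ, k (m₀ i) = (s * v ^ ((n : ℤ) - 2 * (i : ℤ))) • m₀ i)
    (hk₀' : ∀ i : ℕ, k' (m₀ i) = (s * (v ^ ((n : ℤ) - 2 * (i : ℤ)))⁻¹) • m₀ i)
    (hk₁ : ∀ i : ℕ, k (m₁ i) = (s * v ^ ((n : ℤ) - 2 * ((i : ℤ) + 1))) • m₁ i)
    (hk₁' : ∀ i : ℕ, k' (m₁ i) = (s * (v ^ ((n : ℤ) - 2 * ((i : ℤ) + 1)))⁻¹) • m₁ i)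
    (hl₀ : ∀ i, l (m₀ i) = 0) (hl₁ : ∀ i, l (m₁ i) = m₁ i)
    (hf₀ : ∀ i : ℕ, f (m₀ i) = m₀ (i + 1) + (v ^ (i : ℤ) / qInt v ((i : ℤ) + 1)) • m₁ i)
    (hf₁ : ∀ i : ℕ, f (m₁ i) =
      (v⁻¹ * qInt v ((i : ℤ) + 1) / qInt v ((i : ℤ) + 2)) • m₁ (i + 1))
    (he₀_zero : e (m₀ 0) = 0)
    (he₀ : ∀ i : ℕ, i < n → e (m₀ (i + 1)) =
      (s * v * qInt v ((i : ℤ) + 1) * qInt v ((n : ℤ) - ((i : ℤ) + 1))) • m₀ i)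
    (he₁_zero : e (m₁ 0) = (s * v ^ (1 - (n : ℤ)) * qInt v 1) • m₀ 0)
    (he₁ : ∀ i : ℕ, i < n → e (m₁ (i + 1)) =
      (s * qInt v ((i : ℤ) + 2) * qInt v ((n : ℤ) - ((i : ℤ) + 1))) • m₁ i +
      (s * v ^ ((i : ℤ) + 2 - (n : ℤ)) * qInt v ((i : ℤ) + 2)) • m₀ (i + 1))
    (i : ℕ) (hi : i < n) :
    casimirEnd v e f k k' l (m₀ i) =
      (s * (v ^ (n : ℤ) + v ^ (-(n : ℤ))) / (v - v⁻¹)) • m₀ i ∧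
    casimirEnd v e f k k' l (m₁ i) =
      (s * (v ^ (n : ℤ) + v ^ (-(n : ℤ))) / (v - v⁻¹)) • m₁ i := by
  have hb : v ^ (n : ℤ) ≠ 0 := zpow_ne_zero _ hv
  have h2 : v ^ 2 - 1 ≠ 0 := hv2 0
  have z2 : v ^ (2 : ℤ) = v ^ 2 := zpow_ofNat v _
  rw [casimirEnd_apply, casimirEnd_apply]
  rcases i with _ | i
  · have he₁i := he₁ 0 hi
    have hf₀i := hf₀ 0
    have hf₁i := hf₁ 0
    simp only [Nat.cast_zero, zero_add, zpow_zero] at he₁i hf₀i hf₁i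
    constructor
    · simp only [map_add, map_smul, hl₀, hl₁, hk₀, hk₀', hf₀i, he₀_zero, he₁_zero, qInt_eq hv,
        sub_inv_eq hv, Nat.cast_zero, mul_zero, sub_zero, zpow_one, map_zero,
        zpow_sub₀ hv, zpow_neg, smul_zero]
      generalize v ^ (n : ℤ) = b at *
      match_scalars <;> field_simp <;> ring
    · have h4 : v ^ 4 - 1 ≠ 0 := hv2 1
      have h4' : (v ^ 2) ^ 2 - 1 ≠ 0 := by rwa [← pow_mul]
      simp only [map_add, map_smul, hl₀, hl₁, hk₁, hk₁', hf₀i, hf₁i, he₁i, he₁_zero,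
        qInt_eq hv, sub_inv_eq hv, Nat.cast_zero, zero_add, zpow_one, map_zero,
        zpow_sub₀ hv, zpow_neg, smul_zero, z2, mul_one]
      generalize v ^ (n : ℤ) = b at *
      match_scalars <;> field_simp <;> ring
  · have he₀i := he₀ i (by omega)
    have he₁i := he₁ i (by omega)
    have he₁i' := he₁ (i + 1) hi
    have ha : v ^ (i : ℤ) ≠ 0 := zpow_ne_zero _ hv
    have hz : ∀ j : ℕ, v ^ (2 * (j + 1)) * (v ^ (i : ℤ)) ^ 2 - 1 ≠ 0 := by
      intro j
      convert hv2 (i + j) using 2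
      rw [zpow_natCast]
      ring
    have h1 : v ^ 2 * (v ^ (i : ℤ)) ^ 2 - 1 ≠ 0 := hz 0
    have h2' : v ^ 4 * (v ^ (i : ℤ)) ^ 2 - 1 ≠ 0 := hz 1
    have h3 : v ^ 6 * (v ^ (i : ℤ)) ^ 2 - 1 ≠ 0 := hz 2
    constructor
    · simp only [map_add, map_smul, hl₀, hl₁, hk₀, hk₀', hf₀, he₀i, he₁i, qInt_eq hv,
        sub_inv_eq hv, Nat.cast_add, Nat.cast_one, map_zero, zpow_add₀ hv, zpow_sub₀ hv, zpow_neg,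
        zpow_one, zpow_mul', mul_add, smul_zero, z2]
      generalize v ^ (n : ℤ) = b at *
      generalize v ^ (i : ℤ) = a at *
      match_scalars <;> field_simp <;> ring
    · simp only [map_add, map_smul, hl₀, hl₁, hk₁, hk₁', hf₀, hf₁, he₁i, he₁i', qInt_eq hv,
        sub_inv_eq hv, Nat.cast_add, Nat.cast_one, map_zero, zpow_add₀ hv,
        zpow_sub₀ hv, zpow_neg, zpow_one, zpow_mul', mul_add, smul_zero, z2]
      generalize v ^ (n : ℤ) = b at *
      generalize v ^ (i : ℤ) = a at *
      match_scalars <;> field_simp <;> ring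

lemma inv_apply_of_apply {k k' : Module.End F V} (h : k' * k = 1) {s c : F} (hs : s * s = 1)
    (hc : c ≠ 0) {x : V} (hx : k x = (s * c) • x) : k' x = (s * c⁻¹) • x := by
  have h1 : k' (k x) = x := by rw [← Module.End.mul_apply, h, Module.End.one_apply]
  rw [hx, map_smul] at h1
  rw [← h1, smul_smul, h1, show s * c⁻¹ * (s * c) = (s * s) * (c⁻¹ * c) by ring, hs,
    inv_mul_cancel₀ hc, one_mul, one_smul]

end GenericField

section Parameter

lemma vv_ne_zero : vv ≠ 0 := RatFunc.X_ne_zero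

lemma vv_pow (m : ℕ) : vv ^ m = algebraMap (Polynomial ℂ) K (Polynomial.X ^ m) := by
  rw [map_pow, RatFunc.algebraMap_X, vv]

lemma vv_pow_sub_one_ne_zero (i : ℕ) : vv ^ (2 * (i + 1)) - 1 ≠ 0 := by
  rw [vv_pow, ← map_one (algebraMap (Polynomial ℂ) K), ← map_sub]
  refine (map_ne_zero_iff _ (RatFunc.algebraMap_injective ℂ)).2 ?_
  simpa using Polynomial.X_pow_sub_C_ne_zero (show 0 < 2 * (i + 1) by omega) (1 : ℂ)

lemma vv_sub_inv_ne_zero : vv - vv⁻¹ ≠ 0 := by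
  rw [sub_inv_eq vv_ne_zero]
  exact div_ne_zero (vv_pow_sub_one_ne_zero 0) vv_ne_zero

lemma qn_eq_qInt (m : ℤ) : qn m = qInt vv m := rfl

lemma qn_zero : qn 0 = 0 := by simp [qn]

lemma sgn_mul_self (pos : Bool) : sgn pos * sgn pos = 1 := by
  cases pos <;> simp [sgn]

/-- The sign as a complex number. -/
def sgnC (pos : Bool) : ℂ := if pos then 1 else -1

lemma sgn_eq (pos : Bool) :
    sgn pos = algebraMap (Polynomial ℂ) K (Polynomial.C (sgnC pos)) := by
  cases pos <;> simp [sgn, sgnC]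

lemma sgnC_ne_zero (pos : Bool) : sgnC pos ≠ 0 := by
  cases pos <;> simp [sgnC]

lemma sgnC_injective : Function.Injective sgnC := by
  intro a b h
  cases a <;> cases b <;> first | rfl | (norm_num [sgnC] at h)

lemma binomial_injective {s t : Bool} {a b c d : ℕ} (hab : b < a) (hcd : d < c)
    (h : sgn s * (vv ^ a + vv ^ b) = sgn t * (vv ^ c + vv ^ d)) : s = t ∧ a = c ∧ b = d := by
  simp only [vv_pow, sgn_eq, ← map_add, ← map_mul] at h
  have hcoeff := fun j => congrArg (Polynomial.coeff · j) (RatFunc.algebraMap_injective ℂ h)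
  simp only [Polynomial.coeff_C_mul, Polynomial.coeff_add, Polynomial.coeff_X_pow] at hcoeff
  have hs := sgnC_ne_zero s
  have ha : a = c ∨ a = d := by
    by_contra! hne
    have := hcoeff a
    simp [hne.1, hne.2, hab.ne', hs] at this
  have hb : b = c ∨ b = d := by
    by_contra! hne
    have := hcoeff b
    simp [hne.1, hne.2, hab.ne, hs] at this
  obtain ⟨rfl, rfl⟩ : a = c ∧ b = d := by omega
  refine ⟨sgnC_injective ?_, rfl, rfl⟩
  simpa [hab.ne'] using hcoeff a

lemma scalar_injective {s t : Bool} {a b c d : ℤ} (hab : b < a) (hcd : d < c)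
    (h : sgn s * (vv ^ a + vv ^ b) / (vv - vv⁻¹) = sgn t * (vv ^ c + vv ^ d) / (vv - vv⁻¹)) :
    s = t ∧ a = c ∧ b = d := by
  rw [div_left_inj' vv_sub_inv_ne_zero] at h
  obtain ⟨N, hb, hd⟩ : ∃ N : ℕ, 0 ≤ b + N ∧ 0 ≤ d + N := ⟨b.natAbs + d.natAbs, by omega, by omega⟩
  have key : ∀ x : ℤ, 0 ≤ x + N → vv ^ x * vv ^ N = vv ^ (x + N).toNat := by
    intro x hx
    rw [← zpow_natCast, ← zpow_natCast, Int.toNat_of_nonneg hx, zpow_add₀ vv_ne_zero]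
  have h' := congrArg (· * vv ^ N) h
  simp only [mul_assoc, add_mul] at h'
  rw [key a (by omega), key b hb, key c (by omega), key d hd] at h'
  obtain ⟨h1, h2, h3⟩ := binomial_injective (by omega) (by omega) h'
  exact ⟨h1, by omega, by omega⟩

lemma casimirScalar_injective {L L' : Lab} (hL : L.Valid) (hL' : L'.Valid)
    (h : casimirScalar L = casimirScalar L') : L = L' := by
  cases L <;> cases L' <;> simp only [Lab.Valid, casimirScalar] at hL hL' h <;>
    obtain ⟨rfl, h1, h2⟩ := scalar_injective (by omega) (by omega) h <;>
    first
    | omega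
    | (congr 1; omega)

end Parameter

section Representations

lemma map_Cmir {V : Type*} [AddCommGroup V] [Module K V] (ρ : MU2 →ₐ[K] Module.End K V) :
    ρ Cmir = casimirEnd vv (ρ Ee) (ρ Ff) (ρ Kk) (ρ Kk') (ρ Ll) := by
  simp only [Cmir, casimirEnd, map_add, map_sub, map_mul, map_smul]

lemma Kk'_mul_Kk : Kk' * Kk = 1 := by
  rw [Kk', Kk, ← map_mul, RingQuot.mkAlgHom_rel K Rel.k'k, map_one]

lemma map_Kk'_mul_map_Kk {V : Type*} [AddCommGroup V] [Module K V]
    (ρ : MU2 →ₐ[K] Module.End K V) : ρ Kk' * ρ Kk = 1 := by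
  rw [← map_mul, Kk'_mul_Kk, map_one]

/-- The `i`-th standard basis vector of `Fin N → K`, read as `0` when `N ≤ i`. -/
def stdVec (N i : ℕ) : Fin N → K := fun j => if (j : ℕ) = i then 1 else 0

lemma stdVec_val {N : ℕ} (i : Fin N) : stdVec N i = Pi.single i 1 := by
  ext j
  simp [stdVec, Pi.single_apply, Fin.ext_iff]

lemma stdVec_of_le {N i : ℕ} (h : N ≤ i) : stdVec N i = 0 := by
  ext j
  simp [stdVec, show (j : ℕ) ≠ i by omega]

/-- The vector `m_{i,0}` of `L^±(n,01)`, read as `0` when `n ≤ i`. -/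
def vec₀ (n i : ℕ) : I01 n → K := Sum.elim (stdVec n i) 0

/-- The vector `m_{i+1,1}` of `L^±(n,01)`, read as `0` when `n ≤ i`. -/
def vec₁ (n i : ℕ) : I01 n → K := Sum.elim 0 (stdVec n i)

lemma toLin'_stdVec {N : ℕ} (M : Matrix (Fin N) (Fin N) K) (i : ℕ) (a : Fin N) :
    Matrix.toLin' M (stdVec N i) a = if h : i < N then M a ⟨i, h⟩ else 0 := by
  split_ifs with h
  · rw [show stdVec N i = Pi.single ⟨i, h⟩ 1 from stdVec_val ⟨i, h⟩, Matrix.toLin'_apply]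
    simp
  · simp [stdVec_of_le (not_lt.1 h)]

lemma vec₀_val {n : ℕ} (i : Fin n) : vec₀ n i = Pi.single (Sum.inl i) 1 := by
  ext (j | j) <;> simp [vec₀, stdVec_val, Pi.single_apply]

lemma vec₁_val {n : ℕ} (i : Fin n) : vec₁ n i = Pi.single (Sum.inr i) 1 := by
  ext (j | j) <;> simp [vec₁, stdVec_val, Pi.single_apply]

lemma toLin'_vec₀ {n : ℕ} (M : Matrix (I01 n) (I01 n) K) (i : ℕ) (a : I01 n) :
    Matrix.toLin' M (vec₀ n i) a = if h : i < n then M a (Sum.inl ⟨i, h⟩) else 0 := by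
  split_ifs with h
  · rw [show vec₀ n i = Pi.single (Sum.inl ⟨i, h⟩) 1 from vec₀_val ⟨i, h⟩, Matrix.toLin'_apply]
    simp
  · have : vec₀ n i = 0 := by ext (j | j) <;> simp [vec₀, stdVec_of_le (not_lt.1 h)]
    simp [this]

lemma toLin'_vec₁ {n : ℕ} (M : Matrix (I01 n) (I01 n) K) (i : ℕ) (a : I01 n) :
    Matrix.toLin' M (vec₁ n i) a = if h : i < n then M a (Sum.inr ⟨i, h⟩) else 0 := by
  split_ifs with h
  · rw [show vec₁ n i = Pi.single (Sum.inr ⟨i, h⟩) 1 from vec₁_val ⟨i, h⟩, Matrix.toLin'_apply]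
    simp
  · have : vec₁ n i = 0 := by ext (j | j) <;> simp [vec₁, stdVec_of_le (not_lt.1 h)]
    simp [this]

lemma map_Cmir_of_const {pos eps : Bool} {n : ℕ}
    {ρ : MU2 →ₐ[K] Module.End K (Fin (n + 1) → K)}
    (he : ρ Ee = Matrix.toLin' (eMatE pos n)) (hf : ρ Ff = Matrix.toLin' (fMatE n))
    (hk : ρ Kk = Matrix.toLin' (kMatE pos n)) (hl : ρ Ll = Matrix.toLin' (lMatE eps n)) :
    ρ Cmir = (sgn pos * ((1 + (if eps then 1 else 0) * (vv ^ 2 - 1)) *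
      (vv ^ (n : ℤ) + vv ^ (-(n : ℤ) - 2))) / (vv - vv⁻¹)) • 1 := by
  have hK : ∀ i : ℕ, ρ Kk (stdVec (n + 1) i) =
      (sgn pos * vv ^ ((n : ℤ) - 2 * (i : ℤ))) • stdVec (n + 1) i := by
    intro i
    ext a
    rw [hk, toLin'_stdVec]
    simp only [kMatE, Matrix.diagonal_apply, stdVec, Pi.smul_apply, smul_eq_mul, Fin.ext_iff]
    split_ifs <;> first | omega | simp_all
  refine (Pi.basisFun K (Fin (n + 1))).ext fun i => ?_
  rw [Pi.basisFun_apply, ← stdVec_val, map_Cmir, LinearMap.smul_apply, Module.End.one_apply]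
  refine casimirEnd_apply_of_const vv_ne_zero (vv_pow_sub_one_ne_zero 0) ?_ hK
    (fun j => inv_apply_of_apply (map_Kk'_mul_map_Kk ρ) (sgn_mul_self pos)
      (zpow_ne_zero _ vv_ne_zero) (hK j)) ?_ ?_ ?_ ?_ i (Nat.lt_succ_iff.1 i.2)
  · cases eps <;> simp
  · intro j
    ext a
    rw [hl, toLin'_stdVec]
    simp only [lMatE, Matrix.diagonal_apply, stdVec, Pi.smul_apply, smul_eq_mul, Fin.ext_iff]
    split_ifs <;> first | omega | simp_all
  · intro j
    ext a
    rw [hf, toLin'_stdVec]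
    simp only [fMatE, stdVec]
    split_ifs <;> first | omega | rfl
  · ext a
    rw [he, toLin'_stdVec]
    simp [eMatE]
  · intro j hj
    ext a
    rw [he, toLin'_stdVec]
    simp only [eMatE, stdVec, Pi.smul_apply, smul_eq_mul]
    rcases hj.eq_or_lt with rfl | hj'
    · simp [← qn_eq_qInt, qn_zero]
    · split_ifs <;> first | omega | simp [← qn_eq_qInt]

lemma map_Cmir_of_mixed {pos : Bool} {n : ℕ} {ρ : MU2 →ₐ[K] Module.End K (I01 n → K)}
    (he : ρ Ee = Matrix.toLin' (eMat01 pos n)) (hf : ρ Ff = Matrix.toLin' (fMat01 n))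
    (hk : ρ Kk = Matrix.toLin' (kMat01 pos n)) (hl : ρ Ll = Matrix.toLin' (lMat01 n)) :
    ρ Cmir = (sgn pos * (vv ^ (n : ℤ) + vv ^ (-(n : ℤ))) / (vv - vv⁻¹)) • 1 := by
  have hK₀ : ∀ i : ℕ, ρ Kk (vec₀ n i) =
      (sgn pos * vv ^ ((n : ℤ) - 2 * (i : ℤ))) • vec₀ n i := by
    intro i
    ext (a | a) <;> rw [hk, toLin'_vec₀] <;>
      simp only [kMat01, vec₀, stdVec, Sum.elim_inl, Sum.elim_inr, Pi.smul_apply, smul_eq_mul,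
        Sum.inl.injEq, reduceCtorEq, Fin.ext_iff] <;>
      split_ifs <;> first | omega | simp_all
  have hK₁ : ∀ i : ℕ, ρ Kk (vec₁ n i) =
      (sgn pos * vv ^ ((n : ℤ) - 2 * ((i : ℤ) + 1))) • vec₁ n i := by
    intro i
    ext (a | a) <;> rw [hk, toLin'_vec₁] <;>
      simp only [kMat01, vec₁, stdVec, Sum.elim_inl, Sum.elim_inr, Pi.smul_apply, smul_eq_mul,
        Sum.inr.injEq, reduceCtorEq, Fin.ext_iff] <;>
      split_ifs <;> first | omega | simp_all
  have hC := casimirEnd_apply_mixed (m₀ := vec₀ n) (m₁ := vec₁ n) (n := n) (e := ρ Ee) (f := ρ Ff)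
    (l := ρ Ll) vv_ne_zero vv_pow_sub_one_ne_zero hK₀
    (fun j => inv_apply_of_apply (map_Kk'_mul_map_Kk ρ) (sgn_mul_self pos)
      (zpow_ne_zero _ vv_ne_zero) (hK₀ j)) hK₁
    (fun j => inv_apply_of_apply (map_Kk'_mul_map_Kk ρ) (sgn_mul_self pos)
      (zpow_ne_zero _ vv_ne_zero) (hK₁ j)) ?_ ?_ ?_ ?_ ?_ ?_ ?_ ?_
  · refine (Pi.basisFun K (I01 n)).ext fun i => ?_
    rw [Pi.basisFun_apply, map_Cmir, LinearMap.smul_apply, Module.End.one_apply]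
    rcases i with i | i
    · rw [← vec₀_val]
      exact (hC i i.2).1
    · rw [← vec₁_val]
      exact (hC i i.2).2
  · intro i
    ext (a | a) <;> rw [hl, toLin'_vec₀] <;> simp [lMat01]
  · intro i
    ext (a | a) <;> rw [hl, toLin'_vec₁] <;>
      simp only [lMat01, vec₁, stdVec, Sum.elim_inl, Sum.elim_inr,
        Sum.inr.injEq, reduceCtorEq, Fin.ext_iff] <;>
      split_ifs <;> first | omega | simp_all
  · intro i
    ext (a | a) <;> rw [hf, toLin'_vec₀] <;>
      simp only [fMat01, vec₀, vec₁, stdVec, Sum.elim_inl, Sum.elim_inr, Pi.smul_apply,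
        Pi.add_apply, Pi.zero_apply, smul_eq_mul, ← qn_eq_qInt] <;>
      split_ifs <;> first | omega | simp
  · intro i
    ext (a | a) <;> rw [hf, toLin'_vec₁] <;>
      simp only [fMat01, vec₁, stdVec, Sum.elim_inl, Sum.elim_inr, Pi.smul_apply,
        Pi.zero_apply, smul_eq_mul, ← qn_eq_qInt] <;>
      split_ifs <;> first | omega | simp
  · ext (a | a) <;> rw [he, toLin'_vec₀] <;> simp [eMat01]
  · intro i hi
    ext (a | a) <;> rw [he, toLin'_vec₀] <;>
      simp only [eMat01, vec₀, stdVec, Sum.elim_inl, Sum.elim_inr, Pi.smul_apply,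
        Pi.zero_apply, smul_eq_mul, ← qn_eq_qInt]
    · rcases (Nat.succ_le_of_lt hi).eq_or_lt with rfl | hi'
      · simp [qn_zero]
      · split_ifs <;> first | omega | simp
    · simp
  · ext (a | a) <;> rw [he, toLin'_vec₁] <;>
      simp only [eMat01, vec₀, stdVec, Sum.elim_inl, Sum.elim_inr, Pi.smul_apply,
        Pi.zero_apply, smul_eq_mul, ← qn_eq_qInt] <;>
      split_ifs <;> first | omega | contradiction | simp
  · intro i hi
    ext (a | a) <;> rw [he, toLin'_vec₁] <;>
      simp only [eMat01, vec₀, vec₁, stdVec, Sum.elim_inl, Sum.elim_inr, Pi.smul_apply,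
        Pi.add_apply, Pi.zero_apply, smul_eq_mul, ← qn_eq_qInt]
    · split_ifs <;> first | omega | (push_cast; ring_nf)
    · rcases (Nat.succ_le_of_lt hi).eq_or_lt with rfl | hi'
      · simp [qn_zero]
      · split_ifs <;> first | omega | (push_cast; ring_nf)

end Representations

/-- Lemma 5.11: the Casimir element `C_mir` acts on each finite dimensional simple
`MU_v(2)`-module by the indicated scalar, and these scalars are pairwise distinct as
the module ranges over the list of simples. -/
theorem casimir_scalars :
    (∀ L : Lab, L.Valid → ∀ ρ : MU2 →ₐ[K] Module.End K (Carrier L),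
      IsStd L ρ → ρ Cmir = casimirScalar L • (1 : Module.End K (Carrier L))) ∧
    (∀ L L' : Lab, L.Valid → L'.Valid →
      casimirScalar L = casimirScalar L' → L = L') := by
  refine ⟨?_, fun L L' hL hL' => casimirScalar_injective hL hL'⟩
  have two : vv ^ (2 : ℤ) = vv ^ 2 := zpow_ofNat vv 2
  rintro (⟨pos, n⟩ | ⟨pos, n⟩ | ⟨pos, n⟩) - ρ ⟨he, hf, hk, hl⟩
  · have hs : casimirScalar (.L0 pos n) = sgn pos * ((1 + (if false then 1 else 0) *
        (vv ^ 2 - 1)) * (vv ^ (n : ℤ) + vv ^ (-(n : ℤ) - 2))) / (vv - vv⁻¹) := by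
      simp [casimirScalar]
    rw [hs]
    exact map_Cmir_of_const he hf hk hl
  · have hs : casimirScalar (.L1 pos n) = sgn pos * ((1 + (if true then 1 else 0) *
        (vv ^ 2 - 1)) * (vv ^ (n : ℤ) + vv ^ (-(n : ℤ) - 2))) / (vv - vv⁻¹) := by
      have hv := vv_ne_zero
      simp only [casimirScalar, if_true, one_mul, add_sub_cancel, zpow_add₀ hv, zpow_sub₀ hv, two]
      congr 2
      field_simp
    rw [hs]
    exact map_Cmir_of_const he hf hk hl
  · exact map_Cmir_of_mixed he hf hk hl

end

end MirabolicSL2
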